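/- Let A be a Bernstein algebra over a field K of characteristic ≠ 2, 3, let e be a nonzero idempotent of weight 1 with Peirce decomposition A = Ke ⊕ U ⊕ V, and let U² denote the linear span of products uu' with u, u' ∈ U. Then the subspace U ⊕ U² is an ideal of A which is locally nilpotent. -/

import Mathlib

/-- The product of two subspaces of a (possibly non-associative, non-unital) algebra:
the linear span of all products `x * y` with `x ∈ M`, `y ∈ N`. -/
def subMul {K A : Type*} [Field K] [NonUnitalNonAssocRing A] [Module K A]
    [SMulCommClass K A A] [IsScalarTower K A A]
    (M N : Submodule K A) : Submodule K A :=
  Submodule.map₂ (LinearMap.mul K A) M N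

/-- The powers `Sⁱ` of a subspace `S`, defined (for `i ≥ 1`) by `S¹ = S` and
`Sⁱ = Σ_{r+s=i, r,s ≥ 1} Sʳ Sˢ`.  (We set `S⁰ = S`, an irrelevant junk value.) -/
def algPow {K A : Type*} [Field K] [NonUnitalNonAssocRing A] [Module K A]
    [SMulCommClass K A A] [IsScalarTower K A A]
    (S : Submodule K A) : ℕ → Submodule K A
  | 0 => S
  | 1 => S
  | n + 2 => ⨆ r : Fin (n + 1), subMul (algPow S (r + 1)) (algPow S (n + 1 - r))
  decreasing_by
  · omega
  · omega

/-- The Peirce component `U = {u : A | e * u = (1/2) • u}` relative to an idempotent `e`. -/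
def peirceU (K : Type*) {A : Type*} [Field K] [NonUnitalNonAssocCommRing A] [Module K A]
    [SMulCommClass K A A] [IsScalarTower K A A] (e : A) : Submodule K A where
  carrier := {u : A | e * u = (2 : K)⁻¹ • u}
  add_mem' := by
    intro a b ha hb
    simp only [Set.mem_setOf_eq] at *
    rw [mul_add, ha, hb, smul_add]
  zero_mem' := by simp
  smul_mem' := by
    intro c x hx
    simp only [Set.mem_setOf_eq] at *
    rw [mul_smul_comm, hx, smul_comm]

/-- Two elements are equal up to sign. -/
def EqUpToSign {J : Type*} [Neg J] (x y : J) : Prop := x = y ∨ x = -y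

namespace EqUpToSign

variable {J : Type*} [NonUnitalNonAssocCommRing J] {x y z : J}

theorem refl (x : J) : EqUpToSign x x := Or.inl rfl

theorem trans (h : EqUpToSign x y) (h' : EqUpToSign y z) : EqUpToSign x z := by
  rcases h with rfl | rfl
  · exact h'
  · rcases h' with rfl | rfl
    · exact Or.inr rfl
    · exact Or.inl (neg_neg z)

theorem mul_left (a : J) (h : EqUpToSign x y) : EqUpToSign (a * x) (a * y) := by
  rcases h with rfl | rfl
  · exact Or.inl rfl
  · exact Or.inr (mul_neg a y)

theorem neg_left (h : EqUpToSign x y) : EqUpToSign (-x) y := by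
  rcases h with rfl | rfl
  · exact Or.inr rfl
  · exact Or.inl (neg_neg y)

theorem of_add_eq_zero (h : x + y = 0) : EqUpToSign x y := Or.inr (eq_neg_of_add_eq_zero_left h)

theorem eq_zero (h : EqUpToSign x 0) : x = 0 := by
  rcases h with h | h <;> simp [h]

theorem add_or_sub_mem (h : EqUpToSign x y) (P : AddSubgroup J) : x - y ∈ P ∨ x + y ∈ P := by
  rcases h with rfl | rfl
  · exact Or.inl (by simp)
  · exact Or.inr (by simp)

end EqUpToSign

/-- A pair of subgroups `U`, `V` of a commutative nonassociative ring which multiply like the odd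
and even parts of a grading with `V * V = 0`, and which satisfy the linearization of `x ^ 3 = 0`. -/
structure IsNilPair {J : Type*} [NonUnitalNonAssocCommRing J] (U V : AddSubgroup J) : Prop where
  mul_mem_right : ∀ {u u'}, u ∈ U → u' ∈ U → u * u' ∈ V
  mul_mem_left : ∀ {v u}, v ∈ V → u ∈ U → v * u ∈ U
  mul_eq_zero : ∀ {v w}, v ∈ V → w ∈ V → v * w = 0
  cyclic : ∀ {x y z}, x ∈ U → y ∈ U → z ∈ U → x * (y * z) + y * (x * z) + (x * y) * z = 0
  left_anticomm : ∀ {u u' v}, u ∈ U → u' ∈ U → v ∈ V → u * (u' * v) + u' * (u * v) = 0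
  right_anticomm : ∀ {u v w}, u ∈ U → v ∈ V → w ∈ V → v * (w * u) + w * (v * u) = 0

namespace IsNilPair

variable {J : Type*} [NonUnitalNonAssocCommRing J]

/-- Successive left multiplication by the entries of a list. -/
def act (l : List J) (y : J) : J := l.foldr (· * ·) y

@[simp] theorem act_nil (y : J) : act [] y = y := rfl

@[simp] theorem act_cons (v : J) (l : List J) (y : J) : act (v :: l) y = v * act l y := rfl

theorem act_append (l l' : List J) (y : J) : act (l ++ l') y = act l (act l' y) :=
  List.foldr_append

@[simp] theorem act_zero (l : List J) : act l 0 = 0 := by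
  induction l with
  | nil => rfl
  | cons v l ih => simp [ih]

theorem act_add (l : List J) (x y : J) : act l (x + y) = act l x + act l y := by
  induction l with
  | nil => rfl
  | cons v l ih => simp [ih, mul_add]

@[simp] theorem act_neg (l : List J) (y : J) : act l (-y) = -act l y := by
  induction l with
  | nil => rfl
  | cons v l ih => simp [ih]

variable {U V : AddSubgroup J}

theorem act_mem (h : IsNilPair U V) {l : List J} (hl : ∀ v ∈ l, v ∈ V) {y : J} (hy : y ∈ U) :
    act l y ∈ U := by
  induction l with
  | nil => exact hy
  | cons v l ih =>
    exact h.mul_mem_left (hl v (by simp)) (ih fun w hw => hl w (by simp [hw]))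

theorem act_eq_zero (h : IsNilPair U V) {l : List J} (hl : ∀ v ∈ l, v ∈ V) (hne : l ≠ [])
    {y : J} (hy : y ∈ V) : act l y = 0 := by
  induction l with
  | nil => exact absurd rfl hne
  | cons v l ih =>
    rcases eq_or_ne l [] with rfl | hl'
    · exact h.mul_eq_zero (hl v (by simp)) hy
    · simp [ih (fun w hw => hl w (by simp [hw])) hl']

theorem act_perm (h : IsNilPair U V) {l l' : List J} (p : l.Perm l') (hl : ∀ v ∈ l, v ∈ V)
    {y : J} (hy : y ∈ U) : EqUpToSign (act l y) (act l' y) := by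
  induction p with
  | nil => exact .refl _
  | cons v p ih => exact (ih fun w hw => hl w (by simp [hw])).mul_left v
  | swap v w l =>
    exact .of_add_eq_zero (h.right_anticomm (h.act_mem (fun x hx => hl x (by simp [hx])) hy)
      (hl w (by simp)) (hl v (by simp)))
  | trans p q ihp ihq => exact (ihp hl).trans (ihq fun v hv => hl v (p.mem_iff.2 hv))

theorem act_eq_zero_of_not_nodup (h : IsNilPair U V) (h2 : ∀ x : J, x + x = 0 → x = 0)
    {l : List J} (hl : ∀ v ∈ l, v ∈ V) (hd : ¬ l.Nodup) {y : J} (hy : y ∈ U) : act l y = 0 := by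
  obtain ⟨v, hv⟩ : ∃ v, [v, v].Sublist l := by
    simpa [List.nodup_iff_sublist] using hd
  obtain ⟨r, hr⟩ := hv.exists_perm_append
  have hr' : ∀ w ∈ [v, v] ++ r, w ∈ V := fun w hw => hl w (hr.mem_iff.2 hw)
  refine EqUpToSign.eq_zero ((h.act_perm hr hl hy).trans (Or.inl ?_))
  have hm : act r y ∈ U := h.act_mem (fun w hw => hr' w (by simp [hw])) hy
  exact h2 _ (h.right_anticomm hm (hr' v (by simp)) (hr' v (by simp)))

theorem mul_act_mul_swap (h : IsNilPair U V) {l : List J} (hl : ∀ v ∈ l, v ∈ V) {u u' x : J}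
    (hu : u ∈ U) (hu' : u' ∈ U) (hx : x ∈ V) :
    EqUpToSign (u * act l (u' * x)) (u' * act l (u * x)) := by
  induction l generalizing u with
  | nil => exact .of_add_eq_zero (h.left_anticomm hu hu' hx)
  | cons v l ih =>
    have hv : v ∈ V := hl v (by simp)
    have hl' : ∀ w ∈ l, w ∈ V := fun w hw => hl w (by simp [hw])
    have hUV : ∀ {u}, u ∈ U → u * x ∈ U := fun hu => by
      rw [mul_comm]; exact h.mul_mem_left hx hu
    have h₁ := h.left_anticomm hu (h.act_mem hl' (hUV hu')) hv
    rw [mul_comm _ v, mul_comm _ (u * v), mul_comm u v] at h₁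
    have h₂ := ih hl' (h.mul_mem_left hv hu)
    have h₃ : v * u * x = -(v * (u * x)) := by
      have := h.right_anticomm hu hx hv
      rw [mul_comm x (v * u), mul_comm x u] at this
      exact eq_neg_of_add_eq_zero_left this
    rw [h₃, act_neg, mul_neg] at h₂
    have h₄ : EqUpToSign (act l (v * (u * x))) (act (v :: l) (u * x)) := by
      have := h.act_perm (l := l ++ [v]) (l' := v :: l) (List.perm_append_singleton v l)
        (by simpa [or_imp, forall_and] using ⟨hl', hv⟩) (hUV hu)
      rwa [act_append] at this
    exact (EqUpToSign.of_add_eq_zero h₁).trans (h₂.trans (h₄.mul_left u').neg_left)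

end IsNilPair

namespace IsNilPair

variable {J ι : Type*} [NonUnitalNonAssocCommRing J]

/-- The value at `z` of a word of left multiplications of a given shape: `some (a, b)` is
multiplication by `u a * u b`, and `none` is multiplication by `u i`, where `i` is the next unused
entry of the list of indices. -/
def word (u : ι → J) : List (Option (ι × ι)) → List ι → J → J
  | [], _, z => z
  | some p :: s, l, z => (u p.1 * u p.2) * word u s l z
  | none :: _, [], _ => 0
  | none :: s, a :: l, z => u a * word u s l z

variable {U V : AddSubgroup J} {u : ι → J}

theorem word_append (t : List (ι × ι)) (s : List (Option (ι × ι))) (l : List ι) (z : J) :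
    word u (t.map some ++ s) l z = act (t.map fun p => u p.1 * u p.2) (word u s l z) := by
  induction t with
  | nil => rfl
  | cons p t ih => simp [word, ih]

theorem act_eq_word (u : ι → J) (l : List ι) (z : J) :
    act (l.map u) z = word u (List.replicate l.length none) l z := by
  induction l with
  | nil => rfl
  | cons a l ih => simp [List.replicate_succ, word, ih]

theorem pairs_mem (h : IsNilPair U V) (hu : ∀ i, u i ∈ U) (t : List (ι × ι)) :
    ∀ v ∈ t.map (fun p => u p.1 * u p.2), v ∈ V := by
  simp only [List.mem_map]
  rintro _ ⟨p, -, rfl⟩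
  exact h.mul_mem_right (hu _) (hu _)

theorem act_pairs_eq_zero [Fintype ι] (h : IsNilPair U V) (h2 : ∀ x : J, x + x = 0 → x = 0)
    (hu : ∀ i, u i ∈ U) (t : List (ι × ι)) (ht : Fintype.card (ι × ι) < t.length)
    {y : J} (hy : y ∈ U ∨ y ∈ V) : act (t.map fun p => u p.1 * u p.2) y = 0 := by
  have hne : t ≠ [] := by rintro rfl; simp at ht
  rcases hy with hy | hy
  · refine h.act_eq_zero_of_not_nodup h2 (pairs_mem h hu t) (fun hd => ?_) hy
    exact absurd (List.Nodup.length_le_card hd.of_map) (by omega)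
  · exact h.act_eq_zero (pairs_mem h hu t) (by simpa using hne) hy

/-- The subgroup spanned by the words obtained from words of shape `s` when two letters `none` are
traded for one letter `some p`. -/
def lowerWords [DecidableEq ι] (U : AddSubgroup J) (u : ι → J) (s : List (Option (ι × ι))) :
    AddSubgroup J :=
  AddSubgroup.closure {x | ∃ s' l z, z ∈ U ∧ s'.length + 1 = s.length ∧
    s'.count none + 2 = s.count none ∧ l.length = s'.count none ∧ x = word u s' l z}

variable [DecidableEq ι]

theorem pair_mul_mem_lowerWords (p : ι × ι) {s : List (Option (ι × ι))} {x : J}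
    (hx : x ∈ lowerWords U u s) : (u p.1 * u p.2) * x ∈ lowerWords U u (some p :: s) := by
  refine AddSubgroup.closure_induction (p := fun x _ =>
    (u p.1 * u p.2) * x ∈ lowerWords U u (some p :: s)) ?_ ?_ ?_ ?_ hx
  · rintro _ ⟨s', l, z, hz, h₁, h₂, h₃, rfl⟩
    exact AddSubgroup.subset_closure ⟨some p :: s', l, z, hz, by simp [h₁], by simp [h₂],
      by simp [h₃], rfl⟩
  · simp
  · intro x y _ _ hx hy
    rw [mul_add]; exact add_mem hx hy
  · intro x _ hx
    rw [mul_neg]; exact neg_mem hx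

theorem mul_mem_lowerWords (a : ι) {s : List (Option (ι × ι))} {x : J}
    (hx : x ∈ lowerWords U u s) : u a * x ∈ lowerWords U u (none :: s) := by
  refine AddSubgroup.closure_induction (p := fun x _ =>
    u a * x ∈ lowerWords U u (none :: s)) ?_ ?_ ?_ ?_ hx
  · rintro _ ⟨s', l, z, hz, h₁, h₂, h₃, rfl⟩
    exact AddSubgroup.subset_closure ⟨none :: s', a :: l, z, hz, by simp [h₁],
      by simp [← h₂], by simp [h₃], rfl⟩
  · simp
  · intro x y _ _ hx hy
    rw [mul_add]; exact add_mem hx hy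
  · intro x _ hx
    rw [mul_neg]; exact neg_mem hx

theorem word_mem (h : IsNilPair U V) (hu : ∀ i, u i ∈ U) (s : List (Option (ι × ι))) (l : List ι)
    {z : J} (hz : z ∈ U) :
    (Even (s.count none) → word u s l z ∈ U) ∧ (¬ Even (s.count none) → word u s l z ∈ V) := by
  induction s generalizing l with
  | nil => simpa [word] using hz
  | cons p s ih =>
    cases p with
    | some p =>
      have hp := h.mul_mem_right (hu p.1) (hu p.2)
      simp only [word, ne_eq, reduceCtorEq, not_false_eq_true, List.count_cons_of_ne]
      refine ⟨fun hs => h.mul_mem_left hp ((ih l).1 hs), fun hs => ?_⟩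
      rw [h.mul_eq_zero hp ((ih l).2 hs)]
      exact zero_mem V
    | none =>
      cases l with
      | nil => exact ⟨fun _ => zero_mem U, fun _ => zero_mem V⟩
      | cons a l =>
        simp only [word, List.count_cons_self, Nat.even_add_one, not_not]
        refine ⟨fun hs => ?_, fun hs => h.mul_mem_right (hu a) ((ih l).1 hs)⟩
        rw [mul_comm]
        exact h.mul_mem_left ((ih l).2 hs) (hu a)

theorem exists_eq_map_append (s : List (Option (ι × ι))) (hs : 0 < s.count none) :
    ∃ (t : List (ι × ι)) (s' : List (Option (ι × ι))), s = t.map some ++ none :: s' := by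
  induction s with
  | nil => simp at hs
  | cons p s ih =>
    cases p with
    | none => exact ⟨[], s, rfl⟩
    | some p =>
      obtain ⟨t, s', rfl⟩ := ih (by simpa using hs)
      exact ⟨p :: t, s', rfl⟩

theorem word_swap (h : IsNilPair U V) (hu : ∀ i, u i ∈ U) (s : List (Option (ι × ι))) (a b : ι)
    (l : List ι) {z : J} (hz : z ∈ U) (hl : l.length + 2 = s.count none) :
    word u s (a :: b :: l) z - word u s (b :: a :: l) z ∈ lowerWords U u s ∨
      word u s (a :: b :: l) z + word u s (b :: a :: l) z ∈ lowerWords U u s := by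
  induction s with
  | nil => simp at hl
  | cons p s ih =>
    cases p with
    | some p =>
      simp only [word, ← mul_sub, ← mul_add]
      exact (ih (by simpa using hl)).imp (pair_mul_mem_lowerWords p) (pair_mul_mem_lowerWords p)
    | none =>
      simp only [word]
      obtain ⟨t, s', rfl⟩ := exists_eq_map_append s (by simp at hl; omega)
      have hl' : l.length = s'.count none := by
        have : ∀ t : List (ι × ι), (t.map some).count none = 0 := fun t => by
          simp [List.count_eq_zero]
        simp [this] at hl; omega
      rw [word_append, word_append]
      simp only [word]
      by_cases he : Even (s'.count none)
      · have hm := (word_mem h hu s' l hz).1 he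
        rcases eq_or_ne t [] with rfl | ht
        · right
          have h₀ := h.cyclic (hu a) (hu b) hm
          simp only [List.map_nil, act_nil]
          rw [eq_neg_of_add_eq_zero_left h₀]
          refine neg_mem (AddSubgroup.subset_closure ⟨some (a, b) :: s', l, z, hz, ?_, ?_, ?_, rfl⟩)
          · simp
          · simp
          · simp [hl']
        · left
          rw [h.act_eq_zero (pairs_mem h hu t) (by simpa using ht) (h.mul_mem_right (hu b) hm),
            h.act_eq_zero (pairs_mem h hu t) (by simpa using ht) (h.mul_mem_right (hu a) hm)]
          simp
      · exact (h.mul_act_mul_swap (pairs_mem h hu t) (hu a) (hu b)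
          ((word_mem h hu s' l hz).2 he)).add_or_sub_mem _

theorem word_perm (h : IsNilPair U V) (hu : ∀ i, u i ∈ U) {l l' : List ι} (p : l.Perm l')
    (s : List (Option (ι × ι))) {z : J} (hz : z ∈ U) (hl : l.length = s.count none) :
    word u s l z - word u s l' z ∈ lowerWords U u s ∨
      word u s l z + word u s l' z ∈ lowerWords U u s := by
  induction p generalizing s with
  | nil => left; simp
  | cons a p ih =>
    induction s with
    | nil => simp at hl
    | cons q s ihs =>
      cases q with
      | some q =>
        simp only [word, ← mul_sub, ← mul_add]
        exact (ihs (by simpa using hl)).imp (pair_mul_mem_lowerWords q) (pair_mul_mem_lowerWords q)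
      | none =>
        simp only [word, ← mul_sub, ← mul_add]
        exact (ih s (by simpa using hl)).imp (mul_mem_lowerWords a) (mul_mem_lowerWords a)
  | swap a b l => exact word_swap h hu s b a l hz (by simpa using hl)
  | trans p q ihp ihq =>
    rcases ihp s hl with h₁ | h₁ <;> rcases ihq s (p.length_eq ▸ hl) with h₂ | h₂
    · left; simpa using add_mem h₁ h₂
    · right
      have := add_mem h₁ h₂
      rwa [show ∀ x y w : J, x - y + (y + w) = x + w by intros; abel] at this
    · right
      have := sub_mem h₁ h₂
      rwa [show ∀ x y w : J, x + y - (y - w) = x + w by intros; abel] at this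
    · left
      have := sub_mem h₁ h₂
      rwa [show ∀ x y w : J, x + y - (y + w) = x - w by intros; abel] at this

theorem two_word_cons_cons_self_mem (h : IsNilPair U V) (hu : ∀ i, u i ∈ U)
    (s : List (Option (ι × ι))) (a : ι) (l : List ι) {z : J} (hz : z ∈ U)
    (hl : l.length + 2 = s.count none) (he : Even (s.count none)) :
    word u s (a :: a :: l) z + word u s (a :: a :: l) z ∈ lowerWords U u s := by
  induction s with
  | nil => simp at hl
  | cons p s ih =>
    cases p with
    | some p =>
      simp only [word, ← mul_add]
      exact pair_mul_mem_lowerWords p (ih (by simpa using hl) (by simpa using he))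
    | none =>
      obtain ⟨t, s', rfl⟩ := exists_eq_map_append s (by simp at hl; omega)
      have ht₀ : (t.map some).count none = 0 := by simp [List.count_eq_zero]
      simp only [List.count_cons_self, List.count_append, ht₀, zero_add, Nat.even_add_one,
        not_not] at hl he
      simp only [word]
      rw [word_append]
      simp only [word]
      have hm := (word_mem h hu s' l hz).1 he
      rcases eq_or_ne t [] with rfl | ht
      · have h₀ := h.cyclic (hu a) (hu a) hm
        simp only [List.map_nil, act_nil]
        rw [eq_neg_of_add_eq_zero_left h₀]
        refine neg_mem (AddSubgroup.subset_closure ⟨some (a, a) :: s', l, z, hz, ?_, ?_, ?_, rfl⟩)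
        · simp
        · simp
        · simp; omega
      · rw [h.act_eq_zero (pairs_mem h hu t) (by simpa using ht) (h.mul_mem_right (hu a) hm)]
        simp

theorem two_word_mem_of_not_nodup (h : IsNilPair U V) (hu : ∀ i, u i ∈ U)
    (s : List (Option (ι × ι))) {l : List ι} (hd : ¬ l.Nodup) {z : J} (hz : z ∈ U)
    (hl : l.length = s.count none) (he : Even (s.count none)) :
    word u s l z + word u s l z ∈ lowerWords U u s := by
  obtain ⟨a, ha⟩ : ∃ a, [a, a].Sublist l := by
    simpa [List.nodup_iff_sublist] using hd
  obtain ⟨r, hr⟩ := ha.exists_perm_append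
  have h₁ := two_word_cons_cons_self_mem h hu s a r hz
    (by rw [← hl, hr.length_eq]; simp) he
  rcases word_perm h hu hr s hz hl with h₂ | h₂
  · have := add_mem h₁ (add_mem h₂ h₂)
    simpa [show ∀ x y : J, y + y + (x - y + (x - y)) = x + x by intros; abel] using this
  · have := sub_mem (add_mem h₂ h₂) h₁
    simpa [show ∀ x y : J, (x + y + (x + y)) - (y + y) = x + x by intros; abel] using this

variable [Fintype ι]

theorem word_eq_zero_of_many_pairs (h : IsNilPair U V) (h2 : ∀ x : J, x + x = 0 → x = 0)
    (hu : ∀ i, u i ∈ U) (s : List (Option (ι × ι))) (t : List (ι × ι)) (l : List ι) {z : J}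
    (hz : z ∈ U) (hs : (s.count none + 1) * Fintype.card (ι × ι) + s.count none <
      t.length + s.length) :
    act (t.map fun p => u p.1 * u p.2) (word u s l z) = 0 := by
  induction s generalizing t l with
  | nil => exact act_pairs_eq_zero h h2 hu t (by simpa using hs) (Or.inl hz)
  | cons p s ih =>
    cases p with
    | some p =>
      have := ih (t ++ [p]) l (by
        simp only [ne_eq, reduceCtorEq, not_false_eq_true, List.count_cons_of_ne,
          List.length_cons, List.length_append, List.length_nil] at hs ⊢
        omega)
      rwa [List.map_append, act_append] at this
    | none =>
      by_cases ht : Fintype.card (ι × ι) < t.length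
      · refine act_pairs_eq_zero h h2 hu t ht ?_
        by_cases he : Even ((none :: s).count none)
        · exact Or.inl ((word_mem h hu _ l hz).1 he)
        · exact Or.inr ((word_mem h hu _ l hz).2 he)
      · cases l with
        | nil => simp [word]
        | cons a l =>
          have := ih [] l (by
            simp only [List.count_cons_self, List.length_cons, List.length_nil] at hs ⊢
            rw [add_mul _ 1] at hs
            omega)
          simp only [List.map_nil, act_nil] at this
          simp [word, this]

theorem word_eq_zero (h : IsNilPair U V) (h2 : ∀ x : J, x + x = 0 → x = 0)
    (hu : ∀ i, u i ∈ U) (n : ℕ) (s : List (Option (ι × ι))) (l : List ι) {z : J}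
    (hz : z ∈ U) (hn : s.count none = 2 * n) (hl : l.length = s.count none)
    (hs : (Fintype.card ι + 1) * Fintype.card (ι × ι) + Fintype.card ι + n < s.length) :
    word u s l z = 0 := by
  induction n generalizing s l z with
  | zero =>
    refine word_eq_zero_of_many_pairs h h2 hu s [] l hz ?_
    have := Nat.zero_le (Fintype.card ι * Fintype.card (ι × ι))
    rw [add_mul] at hs
    simp only [hn, List.length_nil]
    omega
  | succ n ih =>
    by_cases hk : 2 * (n + 1) ≤ Fintype.card ι
    · refine word_eq_zero_of_many_pairs h h2 hu s [] l hz ?_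
      have := Nat.mul_le_mul_right (Fintype.card (ι × ι)) (Nat.add_le_add_right hk 1)
      simp only [hn, List.length_nil]
      omega
    · have hd : ¬ l.Nodup := fun hd => hk (by rw [← hn, ← hl]; exact hd.length_le_card)
      have hm := two_word_mem_of_not_nodup h hu s hd hz hl (hn ▸ even_two_mul _)
      have hle : lowerWords U u s ≤ ⊥ := by
        refine (AddSubgroup.closure_le _).2 ?_
        rintro _ ⟨s', l', z', hz', h₁, h₂, h₃, rfl⟩
        exact ih s' l' hz' (by omega) h₃ (by omega)
      exact h2 _ (hle hm)

/-- Long products of left multiplications by finitely many elements of `U` vanish. -/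
theorem exists_act_eq_zero (h : IsNilPair U V) (h2 : ∀ x : J, x + x = 0 → x = 0)
    (hu : ∀ i, u i ∈ U) :
    ∃ n, ∀ l : List ι, l.length = n → ∀ z ∈ U ⊔ V, act (l.map u) z = 0 := by
  set C := (Fintype.card ι + 1) * Fintype.card (ι × ι) + Fintype.card ι with hC
  have key : ∀ l : List ι, l.length = 2 * (C + 1) → ∀ z ∈ U, act (l.map u) z = 0 := by
    intro l hl z hz
    rw [act_eq_word]
    exact word_eq_zero h h2 hu (C + 1) _ l hz (by simp [hl]) (by simp) (by
      rw [List.length_replicate, hl]; omega)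
  refine ⟨2 * (C + 1) + 1, fun l hl z hz => ?_⟩
  obtain ⟨x, hx, y, hy, rfl⟩ := AddSubgroup.mem_sup.1 hz
  rw [act_add]
  have h₁ : act (l.map u) x = 0 := by
    obtain ⟨a, l', rfl⟩ := List.exists_cons_of_length_eq_add_one hl
    simp only [List.map_cons, act_cons]
    rw [key l' (by simpa using hl) x hx, mul_zero]
  have h₂ : act (l.map u) y = 0 := by
    obtain ⟨l', a, rfl⟩ := (List.eq_nil_or_concat' l).resolve_left (by rintro rfl; simp at hl)
    rw [List.map_append, act_append]
    refine key l' (by simpa using hl) _ ?_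
    simpa [mul_comm] using h.mul_mem_left hy (hu a)
  rw [h₁, h₂, add_zero]

end IsNilPair

/-- A commutative algebra with weight function `ω` satisfying the Bernstein identity, together with
an idempotent `e` of weight one. -/
structure IsBernstein {K A : Type*} [Field K] [NonUnitalNonAssocCommRing A] [Module K A]
    (ω : A →ₗ[K] K) (e : A) : Prop where
  two_ne : (2 : K) ≠ 0
  three_ne : (3 : K) ≠ 0
  map_mul : ∀ x y : A, ω (x * y) = ω x * ω y
  sq_sq : ∀ x : A, (x * x) * (x * x) = ω x ^ 2 • (x * x)
  idem : e * e = e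
  weight : ω e = 1

namespace IsBernstein

variable {K A : Type*} [Field K] [NonUnitalNonAssocCommRing A] [Module K A]
  {ω : A →ₗ[K] K} {e : A}

theorem two_cancel (h : IsBernstein ω e) {x y : A} (hxy : (2 : K) • x = (2 : K) • y) : x = y :=
  smul_right_injective A h.two_ne hxy

theorem sq_mul_sq (h : IsBernstein ω e) (x y : A) :
    (2 : K) • ((x * x) * (y * y)) + (4 : K) • ((x * y) * (x * y)) =
      ω x ^ 2 • (y * y) + ω y ^ 2 • (x * x) + (4 * ω x * ω y) • (x * y) := by
  have h₁ := h.sq_sq (x + y)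
  have h₂ := h.sq_sq (x - y)
  have h₃ := h.sq_sq x
  have h₄ := h.sq_sq y
  apply h.two_cancel
  simp only [map_add, map_sub, mul_add, add_mul, mul_sub, sub_mul] at h₁ h₂
  simp only [mul_comm] at h₁ h₂ h₃ h₄ ⊢
  linear_combination (norm := module) h₁ + h₂ - (2 : K) • h₃ - (2 : K) • h₄

theorem sq_mul_mul (h : IsBernstein ω e) (x y z : A) :
    (2 : K) • ((x * x) * (y * z)) + (4 : K) • ((x * y) * (x * z)) =
      ω x ^ 2 • (y * z) + (ω y * ω z) • (x * x) + (2 * ω x * ω y) • (x * z) +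
        (2 * ω x * ω z) • (x * y) := by
  have h₁ := h.sq_mul_sq x (y + z)
  have h₂ := h.sq_mul_sq x y
  have h₃ := h.sq_mul_sq x z
  apply h.two_cancel
  simp only [map_add, mul_add, add_mul] at h₁
  simp only [mul_comm] at h₁ h₂ h₃ ⊢
  linear_combination (norm := module) h₁ - h₂ - h₃

/-- The full linearization of the Bernstein identity. -/
theorem mul_mul_mul (h : IsBernstein ω e) (x y z w : A) :
    (2 : K) • ((x * y) * (z * w) + (x * z) * (y * w) + (x * w) * (y * z)) =
      (ω x * ω y) • (z * w) + (ω x * ω z) • (y * w) + (ω x * ω w) • (y * z) +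
        (ω y * ω z) • (x * w) + (ω y * ω w) • (x * z) + (ω z * ω w) • (x * y) := by
  have h₁ := h.sq_mul_mul (x + y) z w
  have h₂ := h.sq_mul_mul x z w
  have h₃ := h.sq_mul_mul y z w
  apply h.two_cancel
  simp only [map_add, mul_add, add_mul] at h₁
  simp only [mul_comm] at h₁ h₂ h₃ ⊢
  linear_combination (norm := module) h₁ - h₂ - h₃

variable {x y z w : A}

theorem mul_mul_mul_eq_zero (h : IsBernstein ω e) (hx : ω x = 0) (hy : ω y = 0) (hz : ω z = 0)
    (hw : ω w = 0) : (x * y) * (z * w) + (x * z) * (y * w) + (x * w) * (y * z) = 0 := by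
  have h₁ := h.mul_mul_mul x y z w
  apply h.two_cancel
  simpa [hx, hy, hz, hw] using h₁

variable [SMulCommClass K A A]

/-- The Peirce component `V = {v | e * v = 0}`. -/
def peirceV (K : Type*) {A : Type*} [Field K] [NonUnitalNonAssocCommRing A] [Module K A]
    [SMulCommClass K A A] (e : A) : Submodule K A :=
  LinearMap.ker (LinearMap.mulLeft K e)

theorem mem_peirceV {v : A} : v ∈ peirceV K e ↔ e * v = 0 := Iff.rfl

theorem weight_peirceV (h : IsBernstein ω e) (hx : x ∈ peirceV K e) : ω x = 0 := by
  simpa [h.map_mul, h.weight] using congrArg ω (mem_peirceV.1 hx)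

variable [IsScalarTower K A A]

theorem mem_peirceU {u : A} : u ∈ peirceU K e ↔ e * u = (2 : K)⁻¹ • u := Iff.rfl

theorem weight_peirceU (h : IsBernstein ω e) (hx : x ∈ peirceU K e) : ω x = 0 := by
  have h₁ := congrArg ω (mem_peirceU.1 hx)
  have h2 := h.two_ne
  simp only [h.map_mul, h.weight, map_smul, smul_eq_mul] at h₁
  field_simp at h₁
  linear_combination h₁

theorem mul_mem_peirceV (h : IsBernstein ω e) (hx : x ∈ peirceU K e) (hy : y ∈ peirceU K e) :
    x * y ∈ peirceV K e := by
  have h₁ := h.mul_mul_mul e e x y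
  have h2 := h.two_ne
  rw [mem_peirceV]
  simp only [h.idem, mem_peirceU.1 hx, mem_peirceU.1 hy, h.weight, h.weight_peirceU hx,
    h.weight_peirceU hy, smul_mul_assoc, mul_smul_comm, mul_comm y x] at h₁
  apply h.two_cancel
  linear_combination (norm := (match_scalars <;> field_simp <;> ring)) h₁

theorem mul_mem_peirceU (h : IsBernstein ω e) (hx : x ∈ peirceU K e) (hy : y ∈ peirceV K e) :
    x * y ∈ peirceU K e := by
  have h₁ := h.mul_mul_mul e e x y
  have h2 := h.two_ne
  rw [mem_peirceU]
  simp only [h.idem, mem_peirceU.1 hx, mem_peirceV.1 hy, h.weight, h.weight_peirceU hx,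
    h.weight_peirceV hy, mul_zero, zero_mul] at h₁
  apply h.two_cancel
  linear_combination (norm := (match_scalars <;> field_simp <;> ring)) h₁

theorem mul_mem_peirceU_of_peirceV (h : IsBernstein ω e) (hx : x ∈ peirceV K e)
    (hy : y ∈ peirceV K e) : x * y ∈ peirceU K e := by
  have h₁ := h.mul_mul_mul e e x y
  have h2 := h.two_ne
  rw [mem_peirceU]
  simp only [h.idem, mem_peirceV.1 hx, mem_peirceV.1 hy, h.weight, h.weight_peirceV hx,
    h.weight_peirceV hy, mul_zero] at h₁
  apply h.two_cancel
  linear_combination (norm := (match_scalars <;> field_simp <;> ring)) h₁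

theorem eq_zero_of_mem (h : IsBernstein ω e) (hx : x ∈ peirceU K e) (hy : x ∈ peirceV K e) :
    x = 0 := by
  have h₁ := mem_peirceU.1 hx
  rw [mem_peirceV.1 hy] at h₁
  exact (smul_eq_zero.1 h₁.symm).resolve_left (inv_ne_zero h.two_ne)

theorem exists_peirce (h : IsBernstein ω e) (a : A) :
    ∃ u ∈ peirceU K e, ∃ v ∈ peirceV K e, a = ω a • e + u + v := by
  obtain ⟨n, hn⟩ : ∃ n, n = a - ω a • e := ⟨_, rfl⟩
  have hωn : ω n = 0 := by simp [hn, h.weight]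
  have h2 := h.two_ne
  have h3 := h.three_ne
  have h₁ := h.mul_mul_mul e e e n
  simp only [h.idem, h.weight, hωn, mul_comm (e * n) e] at h₁
  have h₂ : e * (e * n) = (2 : K)⁻¹ • (e * n) := by
    apply h.two_cancel
    apply smul_right_injective A h3
    linear_combination (norm := (match_scalars <;> field_simp <;> ring)) h₁
  refine ⟨(2 : K) • (e * n), ?_, n - (2 : K) • (e * n), ?_, ?_⟩
  · rw [mem_peirceU, mul_smul_comm, h₂, smul_comm]
  · rw [mem_peirceV, mul_sub, mul_smul_comm, h₂, smul_smul, mul_inv_cancel₀ h2, one_smul, sub_self]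
  · rw [hn]; abel

theorem cyclic (h : IsBernstein ω e) (hx : x ∈ peirceU K e) (hy : y ∈ peirceU K e)
    (hz : z ∈ peirceU K e) : x * (y * z) + y * (x * z) + (x * y) * z = 0 := by
  have h₁ := h.mul_mul_mul e x y z
  have h2 := h.two_ne
  simp only [mem_peirceU.1 hx, mem_peirceU.1 hy, mem_peirceU.1 hz, h.weight_peirceU hx,
    h.weight_peirceU hy, h.weight_peirceU hz, smul_mul_assoc] at h₁
  rw [mul_comm (x * y)]
  linear_combination (norm := (match_scalars <;> field_simp <;> ring)) h₁

theorem left_anticomm (h : IsBernstein ω e) (hx : x ∈ peirceU K e) (hy : y ∈ peirceU K e)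
    (hz : z ∈ peirceV K e) : x * (y * z) + y * (x * z) = 0 := by
  have h₁ := h.mul_mul_mul e x y z
  have h2 := h.two_ne
  simp only [mem_peirceU.1 hx, mem_peirceU.1 hy, mem_peirceV.1 hz, h.weight_peirceU hx,
    h.weight_peirceU hy, h.weight_peirceV hz, smul_mul_assoc, zero_mul] at h₁
  linear_combination (norm := (match_scalars <;> field_simp <;> ring)) h₁

theorem mul_mul_eq_zero (h : IsBernstein ω e) (hx : x ∈ peirceU K e) (hy : y ∈ peirceV K e)
    (hz : z ∈ peirceV K e) : x * (y * z) = 0 := by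
  have h₁ := h.mul_mul_mul e x y z
  have h2 := h.two_ne
  simp only [mem_peirceU.1 hx, mem_peirceV.1 hy, mem_peirceV.1 hz, h.weight_peirceU hx,
    h.weight_peirceV hy, h.weight_peirceV hz, smul_mul_assoc, zero_mul] at h₁
  linear_combination (norm := (match_scalars <;> field_simp <;> ring)) h₁

theorem mul_mul_mul_anticomm (h : IsBernstein ω e) (hx : x ∈ peirceU K e) (hy : y ∈ peirceU K e)
    (hz : z ∈ peirceV K e) (hw : w ∈ peirceV K e) : (x * z) * (y * w) + (x * w) * (y * z) = 0 := by
  have h₁ := h.mul_mul_mul_eq_zero (h.weight_peirceU hx) (h.weight_peirceU hy)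
    (h.weight_peirceV hz) (h.weight_peirceV hw)
  rw [add_assoc] at h₁
  refine h.eq_zero_of_mem ?_ (add_mem (h.mul_mem_peirceV (h.mul_mem_peirceU hx hz)
    (h.mul_mem_peirceU hy hw)) (h.mul_mem_peirceV (h.mul_mem_peirceU hx hw)
    (h.mul_mem_peirceU hy hz)))
  rw [eq_neg_of_add_eq_zero_right h₁, mul_comm]
  exact neg_mem (h.mul_mem_peirceU (h.mul_mem_peirceU_of_peirceV hz hw) (h.mul_mem_peirceV hx hy))

/-- The annihilator of the Peirce component `U` in `U`. -/
def annU (K : Type*) {A : Type*} [Field K] [NonUnitalNonAssocCommRing A] [Module K A]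
    [SMulCommClass K A A] [IsScalarTower K A A] (e : A) : Submodule K A where
  carrier := {x | x ∈ peirceU K e ∧ ∀ y ∈ peirceU K e, x * y = 0}
  add_mem' := fun hx hy => ⟨add_mem hx.1 hy.1, fun z hz => by
    rw [add_mul, hx.2 z hz, hy.2 z hz, add_zero]⟩
  zero_mem' := ⟨zero_mem _, fun _ _ => zero_mul _⟩
  smul_mem' := fun c x hx => ⟨Submodule.smul_mem _ c hx.1, fun z hz => by
    rw [smul_mul_assoc, hx.2 z hz, smul_zero]⟩

theorem mul_mem_annU_of_peirceV (h : IsBernstein ω e) (hx : x ∈ peirceV K e)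
    (hy : y ∈ peirceV K e) : x * y ∈ annU K e :=
  ⟨h.mul_mem_peirceU_of_peirceV hx hy, fun z hz => by rw [mul_comm, h.mul_mul_eq_zero hz hx hy]⟩

theorem right_anticomm_mem_annU (h : IsBernstein ω e) (hx : x ∈ peirceU K e)
    (hy : y ∈ peirceV K e) (hz : z ∈ peirceV K e) : y * (z * x) + z * (y * x) ∈ annU K e := by
  have hxy := h.mul_mem_peirceU hx hy
  have hxz := h.mul_mem_peirceU hx hz
  rw [mul_comm z x, mul_comm y x, mul_comm y, mul_comm z]
  refine ⟨add_mem (h.mul_mem_peirceU hxz hy) (h.mul_mem_peirceU hxy hz), fun t ht => ?_⟩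
  have h₁ := h.left_anticomm ht hxz hy
  have h₂ := h.left_anticomm ht hxy hz
  have h₃ := h.mul_mul_mul_anticomm ht hx hy hz
  rw [mul_comm (t * y), mul_comm (t * z), add_comm] at h₃
  rw [mul_comm, mul_add, eq_neg_of_add_eq_zero_left h₁, eq_neg_of_add_eq_zero_left h₂, ← neg_add,
    add_comm, h₃, neg_zero]

theorem annU_mul_mem (h : IsBernstein ω e) (hx : x ∈ annU K e) (hy : y ∈ peirceV K e) :
    x * y ∈ annU K e := by
  refine ⟨h.mul_mem_peirceU hx.1 hy, fun z hz => ?_⟩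
  have h₁ := h.left_anticomm hz hx.1 hy
  rwa [hx.2 _ (h.mul_mem_peirceU hz hy), add_zero, mul_comm] at h₁

theorem mul_mem_annU (h : IsBernstein ω e) (a : A) (hx : x ∈ annU K e) : a * x ∈ annU K e := by
  obtain ⟨u, hu, v, hv, ha⟩ := h.exists_peirce a
  rw [ha, add_mul, add_mul, smul_mul_assoc, mem_peirceU.1 hx.1, mul_comm u, hx.2 u hu, add_zero,
    mul_comm v]
  exact add_mem (Submodule.smul_mem _ _ (Submodule.smul_mem _ _ hx)) (h.annU_mul_mem hx hv)

theorem annU_mul_mul_eq_zero (h : IsBernstein ω e) (hx : x ∈ annU K e) (hv : w ∈ peirceV K e)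
    (hy : y ∈ peirceU K e) (hz : z ∈ peirceU K e) : (x * w) * (y * z) = 0 := by
  have h₁ := h.mul_mul_mul_eq_zero (h.weight_peirceU hx.1) (h.weight_peirceU hy)
    (h.weight_peirceU hz) (h.weight_peirceV hv)
  simpa [hx.2 y hy, hx.2 z hz] using h₁

end IsBernstein

/-- The quotient of a commutative nonassociative ring by an ideal. -/
theorem exists_quotient.{u} {A : Type u} [NonUnitalNonAssocCommRing A] (I : AddSubgroup A)
    (hI : ∀ a, ∀ x ∈ I, a * x ∈ I) :
    ∃ (J : Type u) (_ : NonUnitalNonAssocCommRing J) (π : A →ₙ+* J),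
      Function.Surjective π ∧ ∀ x, π x = 0 ↔ x ∈ I := by
  let c : RingCon A :=
    { r := fun x y => x - y ∈ I
      iseqv :=
        { refl := fun x => by simp
          symm := fun {x y} hxy => by simpa using neg_mem hxy
          trans := fun {x y z} hxy hyz => by simpa using add_mem hxy hyz }
      add' := fun {w x y z} hwx hyz => by
        simpa [add_sub_add_comm] using add_mem hwx hyz
      mul' := fun {w x y z} hwx hyz => by
        have := add_mem (hI y _ hwx) (hI x _ hyz)
        rwa [mul_comm y, sub_mul, mul_sub, sub_add_sub_cancel] at this }
  let π : A →ₙ+* c.Quotient :=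
    { toFun := fun x => (x : c.Quotient)
      map_zero' := rfl
      map_add' := fun _ _ => rfl
      map_mul' := fun _ _ => rfl }
  refine ⟨c.Quotient, inferInstance, π, Quotient.mk''_surjective, fun x => ?_⟩
  have : c x 0 ↔ x ∈ I := by
    change x - 0 ∈ I ↔ x ∈ I
    rw [sub_zero]
  exact (RingCon.eq c).trans this

namespace IsNilPair

theorem cyclic_of_mem_sup {J : Type*} [NonUnitalNonAssocCommRing J] {U V : AddSubgroup J}
    (h : IsNilPair U V) {x y z : J} (hx : x ∈ U ⊔ V) (hy : y ∈ U ⊔ V) (hz : z ∈ U ⊔ V) :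
    x * (y * z) + y * (x * z) + (x * y) * z = 0 := by
  obtain ⟨a, ha, a', ha', rfl⟩ := AddSubgroup.mem_sup.1 hx
  obtain ⟨b, hb, b', hb', rfl⟩ := AddSubgroup.mem_sup.1 hy
  obtain ⟨c, hc, c', hc', rfl⟩ := AddSubgroup.mem_sup.1 hz
  have h₁ := h.cyclic ha hb hc
  have h₂ := h.left_anticomm ha hb hc'
  have h₃ := h.left_anticomm ha hc hb'
  have h₄ := h.left_anticomm hb hc ha'
  have h₅ := h.right_anticomm ha hb' hc'
  have h₆ := h.right_anticomm hb ha' hc'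
  have h₇ := h.right_anticomm hc ha' hb'
  have e₁ := h.mul_eq_zero (h.mul_mem_right ha hb) hc'
  have e₂ := h.mul_eq_zero (h.mul_mem_right ha hc) hb'
  have e₃ := h.mul_eq_zero (h.mul_mem_right hb hc) ha'
  have e₄ := h.mul_eq_zero ha' hb'
  have e₅ := h.mul_eq_zero ha' hc'
  have e₆ := h.mul_eq_zero hb' hc'
  simp only [mul_add, add_mul, e₄, e₅, e₆, mul_zero, zero_mul]
  simp only [mul_comm] at h₁ h₂ h₃ h₄ h₅ h₆ h₇ e₁ e₂ e₃ ⊢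
  linear_combination (norm := module) h₁ + h₂ + h₃ + h₄ + h₅ + h₆ + h₇ + e₁ + e₂ + e₃

theorem map_act {A J : Type*} [NonUnitalNonAssocCommRing A] [NonUnitalNonAssocCommRing J]
    (π : A →ₙ+* J) (l : List A) (z : A) : π (act l z) = act (l.map π) (π z) := by
  induction l with
  | nil => rfl
  | cons x l ih => simp [ih]

end IsNilPair

section AlgPow

variable {K A : Type*} [Field K] [NonUnitalNonAssocRing A] [Module K A] [SMulCommClass K A A]
  [IsScalarTower K A A]

theorem algPow_le {S P : Submodule K A} {n : ℕ} (hn : 2 ≤ n)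
    (h : ∀ a b, 1 ≤ a → 1 ≤ b → a + b = n → ∀ x ∈ algPow S a, ∀ y ∈ algPow S b, x * y ∈ P) :
    algPow S n ≤ P := by
  obtain ⟨n, rfl⟩ := Nat.exists_eq_add_of_le' hn
  rw [algPow]
  refine iSup_le fun r => Submodule.map₂_le.2 fun x hx y hy => ?_
  exact h _ _ (by omega) (by omega) (by omega) x hx y hy

theorem algPow_le_toSubmodule (S : NonUnitalSubalgebra K A) (n : ℕ) :
    algPow S.toSubmodule n ≤ S.toSubmodule := by
  induction n using Nat.strong_induction_on with
  | _ n ih =>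
    match n with
    | 0 => rw [algPow]
    | 1 => rw [algPow]
    | n + 2 =>
      exact algPow_le (by omega) fun a b _ _ _ x hx y hy =>
        S.mul_mem (ih a (by omega) hx) (ih b (by omega) hy)

theorem algPow_mono {S T : Submodule K A} (hST : S ≤ T) (n : ℕ) : algPow S n ≤ algPow T n := by
  induction n using Nat.strong_induction_on with
  | _ n ih =>
    match n with
    | 0 => simpa only [algPow] using hST
    | 1 => simpa only [algPow] using hST
    | n + 2 =>
      rw [algPow, algPow]
      exact iSup_mono fun r => Submodule.map₂_le_map₂ (ih _ (by omega)) (ih _ (by omega))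

end AlgPow

namespace IsBernstein

variable {K A : Type*} [Field K] [NonUnitalNonAssocCommRing A] [Module K A]
  [SMulCommClass K A A] [IsScalarTower K A A] {ω : A →ₗ[K] K} {e : A} {x y z : A}

theorem isNilPair_map (h : IsBernstein ω e) {J : Type*} [NonUnitalNonAssocCommRing J]
    (π : A →ₙ+* J) (hπ : ∀ x ∈ annU K e, π x = 0) :
    IsNilPair ((peirceU K e).toAddSubgroup.map (π : A →+ J))
      ((peirceV K e).toAddSubgroup.map (π : A →+ J)) where
  mul_mem_right := by
    rintro _ _ ⟨x, hx, rfl⟩ ⟨y, hy, rfl⟩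
    exact ⟨x * y, h.mul_mem_peirceV hx hy, _root_.map_mul π x y⟩
  mul_mem_left := by
    rintro _ _ ⟨x, hx, rfl⟩ ⟨y, hy, rfl⟩
    exact ⟨x * y, mul_comm y x ▸ h.mul_mem_peirceU hy hx, _root_.map_mul π x y⟩
  mul_eq_zero := by
    rintro _ _ ⟨x, hx, rfl⟩ ⟨y, hy, rfl⟩
    exact (_root_.map_mul π x y).symm.trans (hπ _ (h.mul_mem_annU_of_peirceV hx hy))
  cyclic := by
    rintro _ _ _ ⟨x, hx, rfl⟩ ⟨y, hy, rfl⟩ ⟨z, hz, rfl⟩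
    simpa using congrArg π (h.cyclic hx hy hz)
  left_anticomm := by
    rintro _ _ _ ⟨x, hx, rfl⟩ ⟨y, hy, rfl⟩ ⟨z, hz, rfl⟩
    simpa using congrArg π (h.left_anticomm hx hy hz)
  right_anticomm := by
    rintro _ _ _ ⟨x, hx, rfl⟩ ⟨y, hy, rfl⟩ ⟨z, hz, rfl⟩
    simpa using hπ _ (h.right_anticomm_mem_annU hx hy hz)

theorem map_mem_sup (h : IsBernstein ω e) {J : Type*} [NonUnitalNonAssocCommRing J]
    (π : A →ₙ+* J) (hx : ω x = 0) :
    π x ∈ (peirceU K e).toAddSubgroup.map (π : A →+ J) ⊔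
      (peirceV K e).toAddSubgroup.map (π : A →+ J) := by
  obtain ⟨u, hu, v, hv, huv⟩ := h.exists_peirce x
  rw [hx, zero_smul, zero_add] at huv
  rw [huv, map_add]
  exact AddSubgroup.add_mem_sup ⟨u, hu, rfl⟩ ⟨v, hv, rfl⟩

theorem cyclic_mem_annU (h : IsBernstein ω e) (hx : ω x = 0) (hy : ω y = 0) (hz : ω z = 0) :
    x * (y * z) + y * (x * z) + (x * y) * z ∈ annU K e := by
  obtain ⟨J, _, π, -, hπ⟩ :=
    exists_quotient (annU K e).toAddSubgroup fun a x hx => h.mul_mem_annU a hx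
  have := (h.isNilPair_map π fun x hx => (hπ x).2 hx).cyclic_of_mem_sup (h.map_mem_sup π hx)
    (h.map_mem_sup π hy) (h.map_mem_sup π hz)
  refine (hπ _).1 ?_
  simpa using this

/-- Long products of left multiplications by finitely many elements of `U` map `ker ω` to the
annihilator of `U`. -/
theorem exists_act_mem_annU (h : IsBernstein ω e) {ι : Type*} [Fintype ι] (u : ι → A)
    (hu : ∀ i, u i ∈ peirceU K e) :
    ∃ n, ∀ l : List ι, l.length = n → ∀ z, ω z = 0 →
      IsNilPair.act (l.map u) z ∈ annU K e := by
  classical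
  obtain ⟨J, _, π, hsurj, hπ⟩ :=
    exists_quotient (annU K e).toAddSubgroup fun a x hx => h.mul_mem_annU a hx
  have hJ : ∀ x : J, x + x = 0 → x = 0 := by
    intro x hx
    obtain ⟨x, rfl⟩ := hsurj x
    rw [← map_add, hπ, ← two_smul K] at hx
    exact (hπ x).2 ((Submodule.smul_mem_iff _ h.two_ne).1 hx)
  obtain ⟨n, hn⟩ := (h.isNilPair_map π fun x hx => (hπ x).2 hx).exists_act_eq_zero hJ
    (u := fun i => π (u i)) fun i => ⟨u i, hu i, rfl⟩
  refine ⟨n, fun l hl z hz => (hπ _).1 ?_⟩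
  rw [IsNilPair.map_act, List.map_map]
  exact hn l hl _ (h.map_mem_sup π hz)

/-- The annihilator of `U` together with the span of all products of `j` left multiplications by
entries of `u` applied to elements of `ker ω`. -/
def actSpan {ι : Type*} (ω : A →ₗ[K] K) (e : A) (u : ι → A) (j : ℕ) : Submodule K A :=
  annU K e ⊔ Submodule.span K
    {x | ∃ (l : List ι) (z : A), l.length = j ∧ ω z = 0 ∧ x = IsNilPair.act (l.map u) z}

variable {ι : Type*} {u : ι → A}

theorem mul_mem_actSpan_succ (h : IsBernstein ω e) (i : ι) {j : ℕ} (hx : x ∈ actSpan ω e u j) :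
    u i * x ∈ actSpan ω e u (j + 1) := by
  have : actSpan ω e u j ≤ (actSpan ω e u (j + 1)).comap (LinearMap.mulLeft K (u i)) := by
    refine sup_le (fun x hx => Submodule.mem_sup_left (h.mul_mem_annU _ hx)) ?_
    rw [Submodule.span_le]
    rintro _ ⟨l, z, hl, hz, rfl⟩
    exact Submodule.mem_sup_right (Submodule.subset_span ⟨i :: l, z, by simp [hl], hz, rfl⟩)
  exact this hx

theorem actSpan_antitone (h : IsBernstein ω e) : Antitone (actSpan ω e u) := by
  refine antitone_nat_of_succ_le fun j => sup_le_sup_left (Submodule.span_mono ?_) _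
  rintro _ ⟨l, z, hl, hz, rfl⟩
  obtain ⟨l, i, rfl⟩ := (List.eq_nil_or_concat' l).resolve_left (by rintro rfl; simp at hl)
  exact ⟨l, u i * z, by simpa using hl, by simp [h.map_mul, hz], by simp [IsNilPair.act_append]⟩

theorem mem_actSpan_zero (hx : ω x = 0) : x ∈ actSpan ω e u 0 :=
  Submodule.mem_sup_right (Submodule.subset_span ⟨[], x, rfl, hx, rfl⟩)

theorem weight_actSpan (h : IsBernstein ω e) {j : ℕ}
    (hx : x ∈ actSpan ω e u j) : ω x = 0 := by
  have : actSpan ω e u 0 ≤ LinearMap.ker ω := by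
    refine sup_le (fun x hx => h.weight_peirceU hx.1) ?_
    rw [Submodule.span_le]
    rintro _ ⟨l, z, hl, hz, rfl⟩
    rw [List.length_eq_zero_iff] at hl
    simpa [hl] using hz
  exact this (h.actSpan_antitone (Nat.zero_le j) hx)

theorem mul_mul_mem_actSpan (h : IsBernstein ω e) {j : ℕ} (hx : ω x = 0) (hy : ω y = 0)
    (hz : ω z = 0) (h₁ : x * (y * z) ∈ actSpan ω e u j) (h₂ : y * (x * z) ∈ actSpan ω e u j) :
    (x * y) * z ∈ actSpan ω e u j := by
  have h₃ : _ ∈ actSpan ω e u j := Submodule.mem_sup_left (h.cyclic_mem_annU hx hy hz)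
  simpa using sub_mem h₃ (add_mem h₁ h₂)

theorem weight_adjoin (h : IsBernstein ω e) (hu : ∀ i, ω (u i) = 0)
    (hx : x ∈ NonUnitalAlgebra.adjoin K (Set.range u)) : ω x = 0 := by
  induction hx using NonUnitalAlgebra.adjoin_induction with
  | mem x hx => obtain ⟨i, rfl⟩ := hx; exact hu i
  | add x y _ _ hx hy => simp [hx, hy]
  | zero => exact map_zero ω
  | mul x y _ _ hx hy => simp [h.map_mul, hx]
  | smul c x _ hx => simp [hx]

theorem adjoin_mul_mem_actSpan_succ (h : IsBernstein ω e) (hu : ∀ i, ω (u i) = 0)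
    (hx : x ∈ NonUnitalAlgebra.adjoin K (Set.range u)) {j : ℕ} (hz : z ∈ actSpan ω e u j) :
    x * z ∈ actSpan ω e u (j + 1) := by
  induction hx using NonUnitalAlgebra.adjoin_induction generalizing j z with
  | mem x hx => obtain ⟨i, rfl⟩ := hx; exact h.mul_mem_actSpan_succ i hz
  | add x y _ _ hx hy => rw [add_mul]; exact add_mem (hx hz) (hy hz)
  | zero => rw [zero_mul]; exact zero_mem _
  | mul x y hx' hy' hx hy =>
    have hle := h.actSpan_antitone (u := u) (Nat.le_succ (j + 1))
    exact h.mul_mul_mem_actSpan (h.weight_adjoin hu hx') (h.weight_adjoin hu hy')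
      (h.weight_actSpan hz) (hle (hx (hy hz))) (hle (hy (hx hz)))
  | smul c x _ hx => rw [smul_mul_assoc]; exact Submodule.smul_mem _ c (hx hz)

theorem algPow_mul_mem_actSpan (h : IsBernstein ω e) (hu : ∀ i, ω (u i) = 0) {n : ℕ} (hn : 1 ≤ n)
    (hx : x ∈ algPow (NonUnitalAlgebra.adjoin K (Set.range u)).toSubmodule n) {j : ℕ}
    (hz : z ∈ actSpan ω e u j) : x * z ∈ actSpan ω e u (j + n) := by
  induction n using Nat.strong_induction_on generalizing x z j with
  | _ n ih =>
    rcases hn.eq_or_lt with rfl | hn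
    · rw [algPow] at hx
      exact h.adjoin_mul_mem_actSpan_succ hu hx hz
    · have : algPow (NonUnitalAlgebra.adjoin K (Set.range u)).toSubmodule n ≤
          (actSpan ω e u (j + n)).comap (LinearMap.mulRight K z) := by
        refine algPow_le hn fun a b ha hb hab x hx y hy => ?_
        have h₁ := ih a (by omega) ha hx (ih b (by omega) hb hy hz)
        have h₂ := ih b (by omega) hb hy (ih a (by omega) ha hx hz)
        refine h.mul_mul_mem_actSpan (h.weight_adjoin hu (algPow_le_toSubmodule _ _ hx))
          (h.weight_adjoin hu (algPow_le_toSubmodule _ _ hy)) (h.weight_actSpan hz) ?_ ?_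
        · rwa [← hab, add_comm a, ← add_assoc]
        · rwa [← hab, ← add_assoc]
      exact this hx

/-- The subspace `U + U ^ 2`. -/
abbrev peirceIdeal (K : Type*) {A : Type*} [Field K] [NonUnitalNonAssocCommRing A] [Module K A]
    [SMulCommClass K A A] [IsScalarTower K A A] (e : A) : Submodule K A :=
  peirceU K e ⊔ subMul (peirceU K e) (peirceU K e)

theorem subMul_peirceU_le (h : IsBernstein ω e) :
    subMul (peirceU K e) (peirceU K e) ≤ peirceV K e :=
  Submodule.map₂_le.2 fun _ hx _ hy => h.mul_mem_peirceV hx hy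

theorem mul_mem_peirceIdeal (h : IsBernstein ω e) (a : A) (hx : x ∈ peirceIdeal K e) :
    a * x ∈ peirceIdeal K e := by
  obtain ⟨u, hu, v, hv, ha⟩ := h.exists_peirce a
  obtain ⟨y, hy, z, hz, rfl⟩ := Submodule.mem_sup.1 hx
  have hz' := h.subMul_peirceU_le hz
  have h₁ : e * (y + z) ∈ peirceIdeal K e := by
    rw [mul_add, mem_peirceU.1 hy, mem_peirceV.1 hz', add_zero]
    exact Submodule.mem_sup_left (Submodule.smul_mem _ _ hy)
  have h₂ : u * (y + z) ∈ peirceIdeal K e := by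
    rw [mul_add]
    exact add_mem (Submodule.mem_sup_right (Submodule.apply_mem_map₂ _ hu hy))
      (Submodule.mem_sup_left (h.mul_mem_peirceU hu hz'))
  have h₃ : v * (y + z) ∈ peirceIdeal K e := by
    rw [mul_add, mul_comm v y]
    exact Submodule.mem_sup_left
      (add_mem (h.mul_mem_peirceU hy hv) (h.mul_mem_peirceU_of_peirceV hv hz'))
  rw [ha, add_mul, add_mul, smul_mul_assoc]
  exact add_mem (add_mem (Submodule.smul_mem _ _ h₁) h₂) h₃

theorem annU_mul_peirceIdeal_mul (h : IsBernstein ω e) (hx : x ∈ annU K e)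
    (hy : y ∈ peirceIdeal K e) (hz : z ∈ peirceIdeal K e) : (x * y) * z = 0 := by
  obtain ⟨a, ha, b, hb, rfl⟩ := Submodule.mem_sup.1 hy
  obtain ⟨c, hc, d, hd, rfl⟩ := Submodule.mem_sup.1 hz
  have hb' := h.subMul_peirceU_le hb
  have hd' : subMul (peirceU K e) (peirceU K e) ≤ LinearMap.ker (LinearMap.mulLeft K (x * b)) :=
    Submodule.map₂_le.2 fun y hy z hz => h.annU_mul_mul_eq_zero hx hb' hy hz
  rw [mul_add x, hx.2 a ha, zero_add, mul_add, (h.annU_mul_mem hx hb').2 c hc, zero_add]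
  exact hd' hd

theorem adjoin_le_peirceIdeal (h : IsBernstein ω e) (hu : ∀ i, u i ∈ peirceU K e) :
    (NonUnitalAlgebra.adjoin K (Set.range u)).toSubmodule ≤ peirceIdeal K e := by
  intro x hx
  change x ∈ NonUnitalAlgebra.adjoin K (Set.range u) at hx
  induction hx using NonUnitalAlgebra.adjoin_induction with
  | mem x hx => obtain ⟨i, rfl⟩ := hx; exact Submodule.mem_sup_left (hu i)
  | add x y _ _ hx hy => exact add_mem hx hy
  | zero => exact zero_mem _
  | mul x y _ _ hx hy => exact h.mul_mem_peirceIdeal x hy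
  | smul c x _ hx => exact Submodule.smul_mem _ c hx

/-- The subalgebra generated by finitely many elements of `U` is nilpotent. -/
theorem exists_algPow_adjoin_range_eq_bot (h : IsBernstein ω e) [Fintype ι]
    (hu : ∀ i, u i ∈ peirceU K e) :
    ∃ n, 1 ≤ n ∧ algPow (NonUnitalAlgebra.adjoin K (Set.range u)).toSubmodule n = ⊥ := by
  set S := NonUnitalAlgebra.adjoin K (Set.range u)
  have hω : ∀ i, ω (u i) = 0 := fun i => h.weight_peirceU (hu i)
  have hSI : ∀ {n x}, x ∈ algPow S.toSubmodule n → x ∈ peirceIdeal K e := fun hx =>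
    h.adjoin_le_peirceIdeal hu (algPow_le_toSubmodule S _ hx)
  obtain ⟨m, hm⟩ := h.exists_act_mem_annU u hu
  have h₀ : actSpan ω e u m ≤ annU K e := by
    refine sup_le le_rfl (Submodule.span_le.2 ?_)
    rintro _ ⟨l, z, hl, hz, rfl⟩
    exact hm l hl z hz
  have h₁ : ∀ n, 2 * (m + 1) ≤ n → algPow S.toSubmodule n ≤ annU K e := by
    have key : ∀ a b, 1 ≤ a → m ≤ a → ∀ x ∈ algPow S.toSubmodule a, ∀ y ∈ algPow S.toSubmodule b,
        x * y ∈ annU K e := fun a b ha hma x hx y hy =>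
      h₀ (h.actSpan_antitone (by omega) (h.algPow_mul_mem_actSpan hω ha hx
        (mem_actSpan_zero (h.weight_adjoin hω (algPow_le_toSubmodule S b hy)))))
    refine fun n hn => algPow_le (by omega) fun a b ha hb hab x hx y hy => ?_
    rcases le_total m a with hma | hma
    · exact key a b ha hma x hx y hy
    · rw [mul_comm]
      exact key b a hb (by omega) y hy x hx
  have h₂ : ∀ n, 4 * (m + 1) ≤ n →
      algPow S.toSubmodule n ≤ subMul (annU K e) (peirceIdeal K e) := by
    refine fun n hn => algPow_le (by omega) fun a b _ _ hab x hx y hy => ?_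
    rcases le_total (2 * (m + 1)) a with hma | hma
    · exact Submodule.apply_mem_map₂ _ (h₁ a hma hx) (hSI hy)
    · rw [mul_comm]
      exact Submodule.apply_mem_map₂ _ (h₁ b (by omega) hy) (hSI hx)
  have h₃ : ∀ x ∈ subMul (annU K e) (peirceIdeal K e), ∀ z ∈ peirceIdeal K e, x * z = 0 := by
    intro x hx z hz
    have : subMul (annU K e) (peirceIdeal K e) ≤ LinearMap.ker (LinearMap.mulRight K z) :=
      Submodule.map₂_le.2 fun x hx y hy => h.annU_mul_peirceIdeal_mul hx hy hz
    exact this hx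
  refine ⟨8 * (m + 1), by omega, eq_bot_iff.2 (algPow_le (by omega) ?_)⟩
  intro a b _ _ hab x hx y hy
  rw [Submodule.mem_bot]
  rcases le_total (4 * (m + 1)) a with hma | hma
  · exact h₃ x (h₂ a hma hx) y (hSI hy)
  · rw [mul_comm]
    exact h₃ y (h₂ b (by omega) hy) x (hSI hx)

/-- Every element of `U + U ^ 2` lies in a subalgebra generated by finitely many elements of `U`. -/
theorem exists_finset_mem_adjoin (hx : x ∈ peirceIdeal K e) :
    ∃ T : Finset A, (T : Set A) ⊆ peirceU K e ∧ x ∈ NonUnitalAlgebra.adjoin K (T : Set A) := by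
  classical
  have hle : peirceIdeal K e ≤ (NonUnitalAlgebra.adjoin K (peirceU K e : Set A)).toSubmodule :=
    sup_le (fun x hx => NonUnitalAlgebra.subset_adjoin K hx) (Submodule.map₂_le.2 fun x hx y hy =>
      (NonUnitalAlgebra.adjoin K (peirceU K e : Set A)).mul_mem
        (NonUnitalAlgebra.subset_adjoin K hx) (NonUnitalAlgebra.subset_adjoin K hy))
  have hx' : x ∈ NonUnitalAlgebra.adjoin K (peirceU K e : Set A) := hle hx
  clear hx
  have union : ∀ {s t : Finset A} {x y : A}, x ∈ NonUnitalAlgebra.adjoin K (s : Set A) →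
      y ∈ NonUnitalAlgebra.adjoin K (t : Set A) →
      x ∈ NonUnitalAlgebra.adjoin K ((s ∪ t : Finset A) : Set A) ∧
        y ∈ NonUnitalAlgebra.adjoin K ((s ∪ t : Finset A) : Set A) := fun hx hy =>
    ⟨NonUnitalAlgebra.adjoin_mono (by simp) hx, NonUnitalAlgebra.adjoin_mono (by simp) hy⟩
  induction hx' using NonUnitalAlgebra.adjoin_induction with
  | mem x hx => exact ⟨{x}, by simpa using hx, NonUnitalAlgebra.subset_adjoin K (by simp)⟩
  | add x y _ _ hx hy =>
    obtain ⟨s, hs, hx⟩ := hx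
    obtain ⟨t, ht, hy⟩ := hy
    exact ⟨s ∪ t, by simp [hs, ht], add_mem (union hx hy).1 (union hx hy).2⟩
  | zero => exact ⟨∅, by simp, zero_mem _⟩
  | mul x y _ _ hx hy =>
    obtain ⟨s, hs, hx⟩ := hx
    obtain ⟨t, ht, hy⟩ := hy
    exact ⟨s ∪ t, by simp [hs, ht], mul_mem (union hx hy).1 (union hx hy).2⟩
  | smul c x _ hx =>
    obtain ⟨s, hs, hx⟩ := hx
    exact ⟨s, hs, SMulMemClass.smul_mem c hx⟩

theorem exists_finset_subset_adjoin (s : Finset A) (hs : (s : Set A) ⊆ peirceIdeal K e) :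
    ∃ T : Finset A, (T : Set A) ⊆ peirceU K e ∧
      (s : Set A) ⊆ NonUnitalAlgebra.adjoin K (T : Set A) := by
  classical
  choose! f hf hf' using fun x (hx : x ∈ peirceIdeal K e) => exists_finset_mem_adjoin hx
  refine ⟨s.biUnion f, by simpa using fun x hx => hf x (hs hx), fun x hx => ?_⟩
  refine NonUnitalAlgebra.adjoin_mono ?_ (hf' x (hs hx))
  exact_mod_cast Finset.subset_biUnion_of_mem f hx

end IsBernstein

/-- Let `A` be a Bernstein algebra over a field `K` of characteristic `≠ 2, 3`
and let `e` be a (nonzero) idempotent of weight `1`, with Peirce component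
`U = {u | e u = (1/2) u}`.  Then the subspace `U ⊕ U²` (i.e. `U + U·U`) is an ideal of `A`
which is locally nilpotent. -/
theorem peirceU_sup_sq_isIdeal_and_locallyNilpotent {K A : Type*} [Field K]
    [NonUnitalNonAssocCommRing A] [Module K A] [SMulCommClass K A A] [IsScalarTower K A A]
    (h2 : (2 : K) ≠ 0) (h3 : (3 : K) ≠ 0)
    (ω : A →ₗ[K] K) (hωmul : ∀ x y : A, ω (x * y) = ω x * ω y) (hω0 : ω ≠ 0)
    (hbern : ∀ x : A, (x * x) * (x * x) = ω x ^ 2 • (x * x))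
    (e : A) (he : e * e = e) (hωe : ω e = 1) :
    -- `U ⊕ U²` is an ideal of `A` :
    (∀ a : A, ∀ x ∈ peirceU K e ⊔ subMul (peirceU K e) (peirceU K e),
        a * x ∈ peirceU K e ⊔ subMul (peirceU K e) (peirceU K e)) ∧
    -- `U ⊕ U²` is locally nilpotent :
    (∀ s : Finset A, (↑s : Set A) ⊆ (peirceU K e ⊔ subMul (peirceU K e) (peirceU K e) : Submodule K A) →
      ∃ n, 1 ≤ n ∧ algPow (NonUnitalAlgebra.adjoin K (↑s : Set A)).toSubmodule n = ⊥) := by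
  have h : IsBernstein ω e := ⟨h2, h3, hωmul, hbern, he, hωe⟩
  refine ⟨fun a x hx => h.mul_mem_peirceIdeal a hx, fun s hs => ?_⟩
  obtain ⟨T, hT, hsT⟩ := IsBernstein.exists_finset_subset_adjoin s hs
  obtain ⟨n, hn, hn'⟩ :=
    h.exists_algPow_adjoin_range_eq_bot (u := fun i : T => (i : A)) fun i => hT i.2
  refine ⟨n, hn, eq_bot_iff.2 (le_trans (algPow_mono ?_ n) hn'.le)⟩
  rw [show Set.range (fun i : T => (i : A)) = T from Subtype.range_coe]
  exact NonUnitalAlgebra.adjoin_le hsT
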